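/- arXiv:1801.08428 — 12 statements merged into one kernel-verified Lean document; each statement's English description precedes it below -/
import Mathlib

section
/- Let s₁* ∈ ℝ with s₁* ≠ 0. The C¹-determinant condition det[s₁*·r₁, r₁₂, r₂ + p·s₁*·r, p₁·r₁₁₂ + s₁*·r₁₁] = 0 holds if and only if p₁·β²·p = α⁰. In particular, the C¹ condition uniquely determines the quadric Q₁ associated with the neighbouring quadrilateral from the quadric Q. -/
/-- Determinant of the 4×4 matrix whose columns are `v₁, v₂, v₃, v₄`. -/
noncomputable def det4 (v₁ v₂ v₃ v₄ : Fin 4 → ℝ) : ℝ :=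
  Matrix.det (Matrix.of fun i j => ![v₁, v₂, v₃, v₄] j i)

theorem det4_ne_zero_of_linearIndependent {v₁ v₂ v₃ v₄ : Fin 4 → ℝ}
    (h : LinearIndependent ℝ ![v₁, v₂, v₃, v₄]) : det4 v₁ v₂ v₃ v₄ ≠ 0 := by
  have hu : IsUnit (Matrix.of ![v₁, v₂, v₃, v₄]) :=
    Matrix.linearIndependent_rows_iff_isUnit.mp h
  rw [Matrix.isUnit_iff_isUnit_det, ← Matrix.det_transpose] at hu
  exact hu.ne_zero

/-- The determinant of the `C¹` condition, expanded in the basis `r, r₁, r₂, r₁₂`. -/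
theorem det4_quadric_tangents (r r₁ r₂ r₁₂ : Fin 4 → ℝ) (α0 α1 α3 β1 β2 β3 p p₁ s : ℝ) :
    det4 (s • r₁) r₁₂ (r₂ + (p * s) • r)
        (p₁ • (β1 • r₁ + β2 • r₂ + β3 • r₁₂) + s • (α0 • r + α1 • r₁ + α3 • r₁₂)) =
      s ^ 2 * (α0 - p₁ * β2 * p) * det4 r r₁ r₂ r₁₂ := by
  simp [det4, Matrix.det_succ_row_zero, Fin.sum_univ_succ, Fin.succAbove]
  ring

/-- the C¹-determinant condition
`det[s₁*·r₁, r₁₂, r₂ + p·s₁*·r, p₁·r₁₁₂ + s₁*·r₁₁] = 0` holds if and only if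
`p₁·β²·p = α⁰`; hence the C¹ condition uniquely determines the neighbouring
quadric `Q₁` from `Q`. -/
theorem stmt0 (r r₁ r₂ r₁₂ : Fin 4 → ℝ)
    (hbasis : LinearIndependent ℝ ![r, r₁, r₂, r₁₂])
    (α0 α1 α3 β1 β2 β3 : ℝ)
    (hα0 : α0 ≠ 0) (hα3 : α3 ≠ 0) (hβ1 : β1 ≠ 0) (hβ2 : β2 ≠ 0)
    (r₁₁ r₁₁₂ : Fin 4 → ℝ)
    (hr₁₁ : r₁₁ = α0 • r + α1 • r₁ + α3 • r₁₂)
    (hr₁₁₂ : r₁₁₂ = β1 • r₁ + β2 • r₂ + β3 • r₁₂)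
    (p p₁ : ℝ) (hp : p ≠ 0) (hp₁ : p₁ ≠ 0)
    (s₁star : ℝ) (hs₁star : s₁star ≠ 0) :
    det4 (s₁star • r₁) r₁₂ (r₂ + (p * s₁star) • r) (p₁ • r₁₁₂ + s₁star • r₁₁) = 0 ↔
      p₁ * β2 * p = α0 := by
  have hdet := det4_ne_zero_of_linearIndependent hbasis
  rw [hr₁₁, hr₁₁₂, det4_quadric_tangents]
  simp only [mul_eq_zero, pow_eq_zero_iff two_ne_zero, hs₁star, hdet, false_or, or_false]
  rw [sub_eq_zero, eq_comm]
end

section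
/- Assume the C¹ condition p₁·β²·p = α⁰. Say that the generator of Q labelled by s ∈ ℝ is shared with Q₁ if for every t ≠ 0 there exist t₁ ∈ ℝ and λ ≠ 0 with Q₁(s/p, t₁) = λ·Q(s,t). Then the set of s ∈ ℝ whose generator is shared with Q₁ has exactly two elements if D¹ > 0, exactly one element (namely s = (α¹β²p − α⁰β³)/(2α³β²)) if D¹ = 0, and is empty if D¹ < 0, where D¹ := (α⁰β³ − α¹β²p)² + 4α⁰α³β¹β²p. -/
/-- Two linear combinations of four linearly independent vectors agree iff their coefficients do. -/
theorem LinearIndependent.combination_four_eq_iff {K V : Type*} [Field K] [AddCommGroup V]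
    [Module K V] {u v w x : V} (h : LinearIndependent K ![u, v, w, x])
    {a b c d a' b' c' d' : K} :
    a • u + b • v + c • w + d • x = a' • u + b' • v + c' • w + d' • x ↔
      a = a' ∧ b = b' ∧ c = c' ∧ d = d' := by
  constructor
  · intro e
    have key := Fintype.linearIndependent_iff.1 h ![a - a', b - b', c - c', d - d'] (by
      simp only [Fin.sum_univ_four, Matrix.cons_val]
      linear_combination (norm := module) e)
    exact ⟨sub_eq_zero.1 (key 0), sub_eq_zero.1 (key 1), sub_eq_zero.1 (key 2),
      sub_eq_zero.1 (key 3)⟩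
  · rintro ⟨rfl, rfl, rfl, rfl⟩
    rfl

/-- A real quadratic with positive discriminant has exactly two roots. -/
theorem encard_setOf_quadratic_eq_zero {a b c : ℝ} (ha : a ≠ 0) (hD : 0 < discrim a b c) :
    {x : ℝ | a * (x * x) + b * x + c = 0}.encard = 2 := by
  have hroots : {x : ℝ | a * (x * x) + b * x + c = 0} =
      {(-b + √(discrim a b c)) / (2 * a), (-b - √(discrim a b c)) / (2 * a)} := by
    ext x
    exact quadratic_eq_zero_iff ha (Real.mul_self_sqrt hD.le).symm x
  rw [hroots]
  refine Set.encard_pair fun h => ?_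
  have hs := Real.sqrt_pos.2 hD
  rw [div_left_inj' (mul_ne_zero two_ne_zero ha)] at h
  linarith

/-- under the C¹ condition, the set of parameters `s` whose
generator of `Q` is shared with `Q₁` has exactly two elements if `D¹ > 0`,
is the singleton `{(α¹β²p − α⁰β³)/(2α³β²)}` if `D¹ = 0`, and is empty if
`D¹ < 0`, where `D¹ = (α⁰β³ − α¹β²p)² + 4α⁰α³β¹β²p`. -/
theorem stmt3 (r r₁ r₂ r₁₂ : Fin 4 → ℝ)
    (hbasis : LinearIndependent ℝ ![r, r₁, r₂, r₁₂])
    (α0 α1 α3 β1 β2 β3 : ℝ)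
    (hα0 : α0 ≠ 0) (hα3 : α3 ≠ 0) (hβ1 : β1 ≠ 0) (hβ2 : β2 ≠ 0)
    (r₁₁ r₁₁₂ : Fin 4 → ℝ)
    (hr₁₁ : r₁₁ = α0 • r + α1 • r₁ + α3 • r₁₂)
    (hr₁₁₂ : r₁₁₂ = β1 • r₁ + β2 • r₂ + β3 • r₁₂)
    (p p₁ : ℝ) (hp : p ≠ 0) (hp₁ : p₁ ≠ 0)
    (Q Q₁ : ℝ → ℝ → (Fin 4 → ℝ))
    (hQ : ∀ s t, Q s t = p • r₁₂ + s • r₁ + t • r₂ + (s * t) • r)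
    (hQ₁ : ∀ s₁ t₁, Q₁ s₁ t₁ = p₁ • r₁₁₂ + s₁ • r₁₁ + t₁ • r₁₂ + (s₁ * t₁) • r₁)
    (hC1 : p₁ * β2 * p = α0)
    (D1 : ℝ) (hD1 : D1 = (α0 * β3 - α1 * β2 * p) ^ 2 + 4 * α0 * α3 * β1 * β2 * p)
    (shared : Set ℝ)
    (hshared : shared = {s : ℝ | ∀ t : ℝ, t ≠ 0 →
      ∃ t₁ lam : ℝ, lam ≠ 0 ∧ Q₁ (s / p) t₁ = lam • Q s t}) :
    (0 < D1 → shared.encard = 2) ∧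
    (D1 = 0 → shared = {(α1 * β2 * p - α0 * β3) / (2 * α3 * β2)}) ∧
    (D1 < 0 → shared = ∅) := by
  have hmem : shared = {s : ℝ | α3 * β2 * (s * s) + (α0 * β3 - α1 * β2 * p) * s
      + -(α0 * β1 * p) = 0} := by
    rw [hshared]
    ext s
    have hiff : ∀ t t₁ lam : ℝ, Q₁ (s / p) t₁ = lam • Q s t ↔
        s / p * α0 = lam * (s * t) ∧ p₁ * β1 + s / p * α1 + s / p * t₁ = lam * s ∧
          p₁ * β2 = lam * t ∧ p₁ * β3 + s / p * α3 + t₁ = lam * p := by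
      intro t t₁ lam
      rw [← hbasis.combination_four_eq_iff, hQ, hQ₁, hr₁₁, hr₁₁₂]
      refine Eq.congr ?_ ?_ <;> module
    simp only [Set.mem_ofPred_eq, hiff]
    obtain ⟨σ, rfl⟩ : ∃ σ, s = σ * p := ⟨s / p, by field_simp⟩
    rw [mul_div_cancel_right₀ σ hp]
    subst hC1
    constructor
    · intro h
      obtain ⟨t₁, lam, -, -, h1, -, h3⟩ := h 1 one_ne_zero
      linear_combination β2 * p ^ 2 * σ * h3 - β2 * p ^ 2 * h1
    · intro h t ht
      have hquad : p₁ * β1 + σ * α1 - σ * (p₁ * β3) - σ ^ 2 * α3 = 0 := by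
        refine (mul_eq_zero.1 (?_ : β2 * p ^ 2 * _ = 0)).resolve_left
          (mul_ne_zero hβ2 (pow_ne_zero 2 hp))
        linear_combination -h
      refine ⟨p₁ * β2 / t * p - p₁ * β3 - σ * α3, p₁ * β2 / t,
        div_ne_zero (mul_ne_zero hp₁ hβ2) ht, ?_, ?_, ?_, ?_⟩
      · field_simp
      · linear_combination hquad
      · field_simp
      · ring
  have hdisc : D1 = discrim (α3 * β2) (α0 * β3 - α1 * β2 * p) (-(α0 * β1 * p)) := by
    rw [hD1, discrim]
    ring
  have ha : α3 * β2 ≠ 0 := mul_ne_zero hα3 hβ2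
  rw [hmem, hdisc]
  refine ⟨encard_setOf_quadratic_eq_zero ha, fun h => ?_, fun h => ?_⟩
  · ext s
    rw [Set.mem_ofPred_eq, quadratic_eq_zero_iff_of_discrim_eq_zero ha h, Set.mem_singleton_iff,
      neg_sub, mul_assoc 2]
  · refine Set.eq_empty_of_forall_notMem fun s => ?_
    exact quadratic_ne_zero_of_discrim_ne_sq (fun x hx => by nlinarith [sq_nonneg x]) s
end

section
/- Assume the C¹ condition p₁·β²·p = α⁰ and D¹ = 0, where D¹ := (α⁰β³ − α¹β²p)² + 4α⁰α³β¹β²p. Set s := (α¹β²p − α⁰β³)/(2α³β²) and let t₁ ∈ ℝ be such that α¹β²p + 2β²p·t₁ + α⁰β³ ≠ 0; set t := 2α⁰β²p/(α¹β²p + 2β²p·t₁ + α⁰β³). Then det[Q(s,t), r₁ + t·r, r₂ + s·r, r₁₁ + t₁·r₁] = 0. (Here r₁ + t·r = ∂Q/∂s, r₂ + s·r = ∂Q/∂t and r₁₁ + t₁·r₁ = ∂Q₁/∂s₁; geometrically, the tangent planes of Q and Q₁ coincide at every point of their coinciding shared generator, i.e., Q and Q₁ touch along that generator.) -/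
/-- if the C¹ condition holds and `D¹ = 0` then the quadrics `Q`
and `Q₁` touch along their coinciding shared generator:
`det[Q(s,t), r₁ + t·r, r₂ + s·r, r₁₁ + t₁·r₁] = 0` for the indicated `s`, `t`, `t₁`. -/
theorem stmt4 (r r₁ r₂ r₁₂ : Fin 4 → ℝ)
    (hbasis : LinearIndependent ℝ ![r, r₁, r₂, r₁₂])
    (α0 α1 α3 β1 β2 β3 : ℝ)
    (hα0 : α0 ≠ 0) (hα3 : α3 ≠ 0) (hβ1 : β1 ≠ 0) (hβ2 : β2 ≠ 0)
    (r₁₁ r₁₁₂ : Fin 4 → ℝ)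
    (hr₁₁ : r₁₁ = α0 • r + α1 • r₁ + α3 • r₁₂)
    (hr₁₁₂ : r₁₁₂ = β1 • r₁ + β2 • r₂ + β3 • r₁₂)
    (p p₁ : ℝ) (hp : p ≠ 0) (hp₁ : p₁ ≠ 0)
    (Q : ℝ → ℝ → (Fin 4 → ℝ))
    (hQ : ∀ s t, Q s t = p • r₁₂ + s • r₁ + t • r₂ + (s * t) • r)
    (hC1 : p₁ * β2 * p = α0)
    (hD1 : (α0 * β3 - α1 * β2 * p) ^ 2 + 4 * α0 * α3 * β1 * β2 * p = 0)
    (s t t₁ : ℝ)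
    (hs : s = (α1 * β2 * p - α0 * β3) / (2 * α3 * β2))
    (ht₁ : α1 * β2 * p + 2 * β2 * p * t₁ + α0 * β3 ≠ 0)
    (ht : t = 2 * α0 * β2 * p / (α1 * β2 * p + 2 * β2 * p * t₁ + α0 * β3)) :
    det4 (Q s t) (r₁ + t • r) (r₂ + s • r) (r₁₁ + t₁ • r₁) = 0 := by
  have hs' : 2 * β2 * (s * α3) = α1 * β2 * p - α0 * β3 := by
    rw [hs]; field_simp
  have ht' : t * (α1 * β2 * p + 2 * β2 * p * t₁ + α0 * β3) = 2 * α0 * β2 * p := by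
    rw [ht, div_mul_cancel₀ _ ht₁]
  have key : t * (p * (α1 + t₁) - α3 * s) = p * α0 := by
    refine mul_left_cancel₀ (mul_ne_zero two_ne_zero hβ2) ?_
    linear_combination ht' - t * hs'
  refine Matrix.exists_mulVec_eq_zero_iff.mp
    ⟨![α3, p * (α1 + t₁) - α3 * s, -(α3 * t), -p], fun h => hα3 (congrFun h 0), ?_⟩
  ext i
  simp only [hQ, hr₁₁, Matrix.mulVec, dotProduct, Fin.sum_univ_four, Matrix.of_apply,
    Matrix.cons_val, Pi.add_apply, Pi.smul_apply, Pi.zero_apply, smul_eq_mul]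
  linear_combination r i * key
end

section
/- Assume the C¹ condition p₁·β²·p = α⁰. Let s, t ∈ ℝ with t ≠ 0 and 2α³β²s − α¹β²p + α⁰β³ ≠ 0, and set X := Q(s,t). Then the pair s₁ := 𝒮¹(s) = (α¹β²ps + 2α⁰β¹p − α⁰β³s)/(p(2α³β²s − α¹β²p + α⁰β³)), t₁ := 𝒯¹(t) = (2α⁰β²p − α¹β²pt − α⁰β³t)/(2β²pt), with X₁ := Q₁(s₁,t₁), satisfies the two tangency determinant equations det[X, X₁, r₁ + t·r, r₂ + s·r] = 0 and det[X, X₁, r₁₁ + t₁·r₁, r₁₂ + s₁·r₁] = 0; moreover (s₁,t₁) is the unique pair with p·s₁ ≠ s satisfying both equations. (Geometrically: for a generic point X on Q there is a unique point X₁ on Q₁ such that the line joining X and X₁ is tangent to both quadrics at the respective points.) -/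
/-- The coordinate form of `det4`: the determinant of four linear combinations is the determinant of
the original vectors times that of the coefficient matrix. -/
theorem det4_linear_combination (v₀ v₁ v₂ v₃ : Fin 4 → ℝ) (C : Matrix (Fin 4) (Fin 4) ℝ) :
    det4 (C 0 0 • v₀ + C 1 0 • v₁ + C 2 0 • v₂ + C 3 0 • v₃)
      (C 0 1 • v₀ + C 1 1 • v₁ + C 2 1 • v₂ + C 3 1 • v₃)
      (C 0 2 • v₀ + C 1 2 • v₁ + C 2 2 • v₂ + C 3 2 • v₃)
      (C 0 3 • v₀ + C 1 3 • v₁ + C 2 3 • v₂ + C 3 3 • v₃) = det4 v₀ v₁ v₂ v₃ * C.det := by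
  unfold det4
  rw [← Matrix.det_mul]
  congr 1
  ext i j
  fin_cases j <;> simp [Matrix.mul_apply, Fin.sum_univ_four, mul_comm]

theorem det4_ne_zero {v₀ v₁ v₂ v₃ : Fin 4 → ℝ} (h : LinearIndependent ℝ ![v₀, v₁, v₂, v₃]) :
    det4 v₀ v₁ v₂ v₃ ≠ 0 := by
  have hu := (Matrix.isUnit_iff_isUnit_det _).1
    (Matrix.linearIndependent_rows_iff_isUnit (A := Matrix.of ![v₀, v₁, v₂, v₃]).1 h)
  rw [← Matrix.det_transpose] at hu
  exact hu.ne_zero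

theorem det4_tangent_first (r r₁ r₂ r₁₂ : Fin 4 → ℝ) (α0 α1 α3 β1 β2 β3 p p₁ s t s₁ t₁ : ℝ) :
    det4 (p • r₁₂ + s • r₁ + t • r₂ + (s * t) • r)
      (p₁ • (β1 • r₁ + β2 • r₂ + β3 • r₁₂) + s₁ • (α0 • r + α1 • r₁ + α3 • r₁₂) + t₁ • r₁₂ +
        (s₁ * t₁) • r₁) (r₁ + t • r) (r₂ + s • r) =
    det4 r r₁ r₂ r₁₂ * (-(s * t) * (p₁ * β3 + s₁ * α3 + t₁) -
      p * (s₁ * α0 - t * (p₁ * β1 + s₁ * α1 + s₁ * t₁) - s * p₁ * β2)) := by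
  convert det4_linear_combination r r₁ r₂ r₁₂
    !![s * t, s₁ * α0, t, s;
       s, p₁ * β1 + s₁ * α1 + s₁ * t₁, 1, 0;
       t, p₁ * β2, 0, 1;
       p, p₁ * β3 + s₁ * α3 + t₁, 0, 0] using 2
  · simp; module
  · simp; module
  · simp; module
  · simp; module
  · simp [Matrix.det_succ_row_zero, Fin.sum_univ_succ, Fin.succAbove]
    ring

theorem det4_tangent_second (r r₁ r₂ r₁₂ : Fin 4 → ℝ) (α0 α1 α3 β1 β2 β3 p p₁ s t s₁ t₁ : ℝ) :
    det4 (p • r₁₂ + s • r₁ + t • r₂ + (s * t) • r)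
      (p₁ • (β1 • r₁ + β2 • r₂ + β3 • r₁₂) + s₁ • (α0 • r + α1 • r₁ + α3 • r₁₂) + t₁ • r₁₂ +
        (s₁ * t₁) • r₁) (α0 • r + α1 • r₁ + α3 • r₁₂ + t₁ • r₁) (r₁₂ + s₁ • r₁) =
    det4 r r₁ r₂ r₁₂ *
      (p₁ * β2 * (α0 * s - s * t * (α1 + t₁) - s₁ * (α0 * p - s * t * α3)) -
        t * α0 * (p₁ * β1 - s₁ * (p₁ * β3 + t₁))) := by
  convert det4_linear_combination r r₁ r₂ r₁₂
    !![s * t, s₁ * α0, α0, 0;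
       s, p₁ * β1 + s₁ * α1 + s₁ * t₁, α1 + t₁, s₁;
       t, p₁ * β2, 0, 0;
       p, p₁ * β3 + s₁ * α3 + t₁, α3, 1] using 2
  · simp; module
  · simp; module
  · simp; module
  · simp; module
  · simp [Matrix.det_succ_row_zero, Fin.sum_univ_succ, Fin.succAbove]
    ring

/-- Under the C¹ condition the two tangency equations are equivalent to a pair of equations of which
one determines `s₁` and the other factors through `s - p * s₁`. -/
theorem tangency_iff {α0 α1 α3 β1 β2 β3 p p₁ s t : ℝ} (hα0 : α0 ≠ 0) (hβ2 : β2 ≠ 0) (hp : p ≠ 0)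
    (ht : t ≠ 0) (hC1 : p₁ * β2 * p = α0) (s₁ t₁ : ℝ) :
    (-(s * t) * (p₁ * β3 + s₁ * α3 + t₁) -
        p * (s₁ * α0 - t * (p₁ * β1 + s₁ * α1 + s₁ * t₁) - s * p₁ * β2) = 0 ∧
      p₁ * β2 * (α0 * s - s * t * (α1 + t₁) - s₁ * (α0 * p - s * t * α3)) -
        t * α0 * (p₁ * β1 - s₁ * (p₁ * β3 + t₁)) = 0) ↔
    s₁ * (p * (2 * α3 * β2 * s - α1 * β2 * p + α0 * β3)) =
        α1 * β2 * p * s + 2 * α0 * β1 * p - α0 * β3 * s ∧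
      (s - p * s₁) *
        (2 * α0 * β2 * p - α1 * β2 * p * t - α0 * β3 * t - t₁ * (2 * β2 * p * t)) = 0 := by
  subst hC1
  have hp₁ : p₁ ≠ 0 := by rintro rfl; simp at hα0
  constructor
  · rintro ⟨h₁, h₂⟩
    refine ⟨mul_left_cancel₀ (mul_ne_zero hp₁ ht) ?_, mul_left_cancel₀ hp₁ ?_⟩
    · linear_combination (-p * p₁ * β2) * h₁ + p * h₂
    · linear_combination (p * p₁ * β2) * h₁ + p * h₂
  · rintro ⟨h₁, h₂⟩
    refine ⟨mul_left_cancel₀ (mul_ne_zero (mul_ne_zero two_ne_zero hp) hβ2) ?_,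
      mul_left_cancel₀ (mul_ne_zero two_ne_zero hp) ?_⟩
    · linear_combination h₂ - t * h₁
    · linear_combination p₁ * h₂ + p₁ * t * h₁

/-- for a generic point `X = Q(s,t)` on `Q` there is a unique
point `X₁ = Q₁(s₁,t₁)` with `p·s₁ ≠ s` such that the line joining `X` and `X₁`
is tangent to both quadrics at the respective points; `s₁ = 𝒮¹(s)` and
`t₁ = 𝒯¹(t)` are given by the indicated formulas. -/
theorem stmt5 (r r₁ r₂ r₁₂ : Fin 4 → ℝ)
    (hbasis : LinearIndependent ℝ ![r, r₁, r₂, r₁₂])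
    (α0 α1 α3 β1 β2 β3 : ℝ)
    (hα0 : α0 ≠ 0) (hα3 : α3 ≠ 0) (hβ1 : β1 ≠ 0) (hβ2 : β2 ≠ 0)
    (r₁₁ r₁₁₂ : Fin 4 → ℝ)
    (hr₁₁ : r₁₁ = α0 • r + α1 • r₁ + α3 • r₁₂)
    (hr₁₁₂ : r₁₁₂ = β1 • r₁ + β2 • r₂ + β3 • r₁₂)
    (p p₁ : ℝ) (hp : p ≠ 0) (hp₁ : p₁ ≠ 0)
    (Q Q₁ : ℝ → ℝ → (Fin 4 → ℝ))
    (hQ : ∀ s t, Q s t = p • r₁₂ + s • r₁ + t • r₂ + (s * t) • r)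
    (hQ₁ : ∀ s₁ t₁, Q₁ s₁ t₁ = p₁ • r₁₁₂ + s₁ • r₁₁ + t₁ • r₁₂ + (s₁ * t₁) • r₁)
    (hC1 : p₁ * β2 * p = α0)
    (s t : ℝ) (ht : t ≠ 0)
    (hden : 2 * α3 * β2 * s - α1 * β2 * p + α0 * β3 ≠ 0)
    (s₁ t₁ : ℝ)
    (hs₁ : s₁ = (α1 * β2 * p * s + 2 * α0 * β1 * p - α0 * β3 * s) /
      (p * (2 * α3 * β2 * s - α1 * β2 * p + α0 * β3)))
    (ht₁ : t₁ = (2 * α0 * β2 * p - α1 * β2 * p * t - α0 * β3 * t) /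
      (2 * β2 * p * t)) :
    (det4 (Q s t) (Q₁ s₁ t₁) (r₁ + t • r) (r₂ + s • r) = 0 ∧
     det4 (Q s t) (Q₁ s₁ t₁) (r₁₁ + t₁ • r₁) (r₁₂ + s₁ • r₁) = 0) ∧
    ∀ s₁' t₁' : ℝ, p * s₁' ≠ s →
      det4 (Q s t) (Q₁ s₁' t₁') (r₁ + t • r) (r₂ + s • r) = 0 →
      det4 (Q s t) (Q₁ s₁' t₁') (r₁₁ + t₁' • r₁) (r₁₂ + s₁' • r₁) = 0 →
      s₁' = s₁ ∧ t₁' = t₁ := by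
  subst hr₁₁ hr₁₁₂
  have hD := det4_ne_zero hbasis
  have hden_s : p * (2 * α3 * β2 * s - α1 * β2 * p + α0 * β3) ≠ 0 := mul_ne_zero hp hden
  have hden_t : 2 * β2 * p * t ≠ 0 := by positivity
  simp only [hQ, hQ₁, det4_tangent_first, det4_tangent_second, mul_eq_zero_iff_left hD]
  rw [eq_div_iff hden_s] at hs₁
  rw [eq_div_iff hden_t] at ht₁
  refine ⟨(tangency_iff hα0 hβ2 hp ht hC1 s₁ t₁).2 ⟨hs₁, by rw [ht₁]; ring⟩, ?_⟩
  intro s₁' t₁' hne h₁ h₂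
  obtain ⟨hs, hst⟩ := (tangency_iff hα0 hβ2 hp ht hC1 s₁' t₁').1 ⟨h₁, h₂⟩
  have ht' := (mul_eq_zero.1 hst).resolve_left (sub_ne_zero.2 hne.symm)
  exact ⟨mul_right_cancel₀ hden_s (hs.trans hs₁.symm),
    mul_right_cancel₀ hden_t ((sub_eq_zero.1 ht').symm.trans ht₁.symm)⟩
end

section
/- Assume the discrete Gauss–Mainardi–Codazzi (compatibility) relations, the C¹ recursions p₁ = α⁰/(β²p) and p₂ = γ⁰/(δ¹p), and the gauge condition (1 − p²)·β²δ¹ = β¹δ². Define T¹ := D¹/(α⁰β²p)², T² := D²/(γ⁰δ¹p)², T¹₂ := D¹₂/(α⁰₂β²₂p₂)² and T²₁ := D²₁/(γ⁰₁δ¹₁p₁)², where D¹ := (α⁰β³ − α¹β²p)² + 4α⁰α³β¹β²p, D² := (γ⁰δ³ − γ²δ¹p)² + 4γ⁰γ³δ¹δ²p, D¹₂ := (α⁰₂β³₂ − α¹₂β²₂p₂)² + 4α⁰₂α³₂β¹₂β²₂p₂ and D²₁ := (γ⁰₁δ³₁ − γ²₁δ¹₁p₁)² + 4γ⁰₁γ³₁δ¹₁δ²₁p₁.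 Then (β¹/β²)·(T²₁ − T²) = (δ²/δ¹)·(T¹₂ − T¹). (This is the discrete analogue of the classical Gauss–Mainardi–Codazzi relation α_y/p = β_x/q.) -/
/-- The identity `stmt6` in the variables normalized by `α⁰`, `β²`, `γ⁰`, `δ¹`,
with `w` the inverse of the quadric parameter. -/
theorem normalized_codazzi {a g b d u v w A G P Q : ℝ}
    (huv : u * v * w ^ 2 = w ^ 2 - 1)
    (h : P - Q + A - G + w ^ 2 * (b * (a * v + g) - d * (u * g + a)) = 0) :
    u * ((((a * v + g) * w - (d - v * b) * w ^ 2) ^ 2 + 4 * v * P * w) -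
        ((d * w - g) ^ 2 + 4 * G * v * w)) =
      v * ((((u * g + a) * w - (b - u * d) * w ^ 2) ^ 2 + 4 * u * Q * w) -
        ((b * w - a) ^ 2 + 4 * A * u * w)) := by
  linear_combination (4 * u * v * w) * h +
    (v * (a - b * w) ^ 2 - u * (g - d * w) ^ 2) * huv


/-- the discrete analogue `(β¹/β²)·Δ₁T² = (δ²/δ¹)·Δ₂T¹` of the
classical Gauss–Mainardi–Codazzi relation `α_y/p = β_x/q`, derived from the
discrete compatibility relations, the C¹ recursions and the gauge condition. -/
theorem stmt6
    (α0 α1 α3 β1 β2 β3 γ0 γ2 γ3 δ1 δ2 δ3 : ℝ)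
    (γ01 γ21 γ31 δ11 δ21 δ31 : ℝ)
    (α02 α12 α32 β12 β22 β32 : ℝ)
    (p p₁ p₂ : ℝ)
    (hα0 : α0 ≠ 0) (hα3 : α3 ≠ 0) (hβ1 : β1 ≠ 0) (hβ2 : β2 ≠ 0)
    (hγ0 : γ0 ≠ 0) (hγ3 : γ3 ≠ 0) (hδ1 : δ1 ≠ 0) (hδ2 : δ2 ≠ 0)
    (hγ01 : γ01 ≠ 0) (hγ31 : γ31 ≠ 0) (hδ11 : δ11 ≠ 0) (hδ21 : δ21 ≠ 0)
    (hα02 : α02 ≠ 0) (hα32 : α32 ≠ 0) (hβ12 : β12 ≠ 0) (hβ22 : β22 ≠ 0)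
    (hp : p ≠ 0)
    -- discrete Gauss–Mainardi–Codazzi (compatibility) relations M₁L = L₂M
    (h1 : β1 = α32 * δ1) (h2 : β2 = α32 * δ2 + α02) (h3 : β3 = α32 * δ3 + α12)
    (h4 : δ1 = γ31 * β1 + γ01) (h5 : δ2 = γ31 * β2) (h6 : δ3 = γ31 * β3 + γ21)
    (h7 : δ11 * α0 = β22 * γ0) (h8 : α1 * δ11 + β1 * δ31 = β32 * δ1)
    (h9 : δ31 * β2 = γ2 * β22 + δ2 * β32)
    (h10 : α3 * δ11 + β3 * δ31 + δ21 = γ3 * β22 + δ3 * β32 + β12)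
    -- C¹ recursions
    (hp₁ : p₁ = α0 / (β2 * p)) (hp₂ : p₂ = γ0 / (δ1 * p))
    -- gauge condition
    (hgauge : (1 - p ^ 2) * β2 * δ1 = β1 * δ2)
    (D1 D2 D12 D21 T1 T2 T12 T21 : ℝ)
    (hD1 : D1 = (α0 * β3 - α1 * β2 * p) ^ 2 + 4 * α0 * α3 * β1 * β2 * p)
    (hD2 : D2 = (γ0 * δ3 - γ2 * δ1 * p) ^ 2 + 4 * γ0 * γ3 * δ1 * δ2 * p)
    (hD12 : D12 = (α02 * β32 - α12 * β22 * p₂) ^ 2 + 4 * α02 * α32 * β12 * β22 * p₂)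
    (hD21 : D21 = (γ01 * δ31 - γ21 * δ11 * p₁) ^ 2 + 4 * γ01 * γ31 * δ11 * δ21 * p₁)
    (hT1 : T1 = D1 / (α0 * β2 * p) ^ 2) (hT2 : T2 = D2 / (γ0 * δ1 * p) ^ 2)
    (hT12 : T12 = D12 / (α02 * β22 * p₂) ^ 2)
    (hT21 : T21 = D21 / (γ01 * δ11 * p₁) ^ 2) :
    (β1 / β2) * (T21 - T2) = (δ2 / δ1) * (T12 - T1) := by
  have hγ01_eq : γ01 = p ^ 2 * δ1 := by
    apply mul_right_cancel₀ hβ2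
    linear_combination hgauge - β2 * h4 + β1 * h5
  have hα02_eq : α02 = p ^ 2 * β2 := by
    apply mul_right_cancel₀ hδ1
    linear_combination hgauge - δ1 * h2 + δ2 * h1
  have hα32_eq : α32 = β1 / δ1 := by rw [h1]; field_simp
  have hγ31_eq : γ31 = δ2 / β2 := by rw [h5]; field_simp
  have hα12_eq : α12 = β3 - β1 / δ1 * δ3 := by rw [← hα32_eq]; linear_combination -h3
  have hγ21_eq : γ21 = δ3 - δ2 / β2 * β3 := by rw [← hγ31_eq]; linear_combination -h6
  have hβ22_eq : β22 = δ11 * α0 / γ0 := by rw [h7]; field_simp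
  have hδ31_eq : δ31 = δ11 * α0 * (α1 / α0 * (δ2 / δ1) + γ2 / γ0) / (p ^ 2 * β2) := by
    rw [hβ22_eq] at h9
    field_simp at h9 ⊢
    linear_combination (-γ0 * δ31) * hgauge - δ2 * γ0 * h8 + δ1 * h9
  have hβ32_eq : β32 = δ11 * α0 * (β1 / β2 * (γ2 / γ0) + α1 / α0) / (p ^ 2 * δ1) := by
    rw [hβ22_eq] at h9
    field_simp at h9 ⊢
    linear_combination (-γ0 * β32) * hgauge - β2 * γ0 * h8 + β1 * h9
  have huv : β1 / β2 * (δ2 / δ1) * p⁻¹ ^ 2 = p⁻¹ ^ 2 - 1 := by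
    field_simp
    linear_combination -hgauge
  have hsum : δ21 / (δ11 * α0) - β12 / (δ11 * α0) + α3 / α0 - γ3 / γ0 +
      p⁻¹ ^ 2 * (β3 / β2 * (α1 / α0 * (δ2 / δ1) + γ2 / γ0) -
        δ3 / δ1 * (β1 / β2 * (γ2 / γ0) + α1 / α0)) = 0 := by
    rw [hδ31_eq, hβ32_eq, hβ22_eq] at h10
    have h10' := congrArg (· / (δ11 * α0)) h10
    field_simp at h10' ⊢
    linear_combination h10'
  have hT1_eq : T1 = (β3 / β2 * p⁻¹ - α1 / α0) ^ 2 + 4 * (α3 / α0) * (β1 / β2) * p⁻¹ := by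
    rw [hT1, hD1]
    field_simp
  have hT2_eq : T2 = (δ3 / δ1 * p⁻¹ - γ2 / γ0) ^ 2 + 4 * (γ3 / γ0) * (δ2 / δ1) * p⁻¹ := by
    rw [hT2, hD2]
    field_simp
  have hT12_eq : T12 = ((β1 / β2 * (γ2 / γ0) + α1 / α0) * p⁻¹ -
      (β3 / β2 - β1 / β2 * (δ3 / δ1)) * p⁻¹ ^ 2) ^ 2 +
        4 * (β1 / β2) * (β12 / (δ11 * α0)) * p⁻¹ := by
    rw [hT12, hD12, hp₂, hα02_eq, hα32_eq, hα12_eq, hβ32_eq, hβ22_eq]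
    field_simp
  have hT21_eq : T21 = ((α1 / α0 * (δ2 / δ1) + γ2 / γ0) * p⁻¹ -
      (δ3 / δ1 - δ2 / δ1 * (β3 / β2)) * p⁻¹ ^ 2) ^ 2 +
        4 * (δ2 / δ1) * (δ21 / (δ11 * α0)) * p⁻¹ := by
    rw [hT21, hD21, hp₁, hγ01_eq, hγ31_eq, hγ21_eq, hδ31_eq]
    field_simp
  rw [hT1_eq, hT2_eq, hT12_eq, hT21_eq]
  exact normalized_codazzi huv hsum
end

section
/- Assume the discrete Gauss–Mainardi–Codazzi (compatibility) relations, the C¹ recursions p₁ = α⁰/(β²p) and p₂ = γ⁰/(δ¹p), and the gauge condition (1 − p²)·β²δ¹ = β¹δ². Define the maps 𝒮¹(s) := (α¹β²ps + 2α⁰β¹p − α⁰β³s)/(p(2α³β²s − α¹β²p + α⁰β³)) and 𝒮²(s) := (2γ⁰δ¹p − γ²δ¹ps − γ⁰δ³s)/(2δ¹ps); let 𝒮₁² be the map 𝒮² built from the 1-shifted coefficients γ⁰₁, γ²₁, γ³₁, δ¹₁, δ³₁ and p₁, and 𝒮₂¹ the map 𝒮¹ built from the 2-shifted coefficients α⁰₂,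 α¹₂, α³₂, β¹₂, β²₂, β³₂ and p₂. Then for every s such that all denominators occurring in 𝒮¹(s), 𝒮²(s), 𝒮₁²(𝒮¹(s)) and 𝒮₂¹(𝒮²(s)) are nonzero, the commutativity condition 𝒮₁²(𝒮¹(s)) = 𝒮₂¹(𝒮²(s)) holds if and only if T¹₂ = T¹, where T¹ := D¹/(α⁰β²p)² and T¹₂ := D¹₂/(α⁰₂β²₂p₂)² with D¹ := (α⁰β³ − α¹β²p)² + 4α⁰α³β¹β²p and D¹₂ := (α⁰₂β³₂ − α¹₂β²₂p₂)² + 4α⁰₂α³₂β¹₂β²₂p₂. In particular the closing condition is a single scalar constraint independent of the choice of s. -/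
/-- the commutativity (closing) condition
`𝒮₁²∘𝒮¹ = 𝒮₂¹∘𝒮²` for the tangency maps holds, for any admissible `s`,
if and only if `T¹₂ = T¹`; in particular it is a single scalar constraint
independent of `s`. -/
theorem stmt7
    (α0 α1 α3 β1 β2 β3 γ0 γ2 γ3 δ1 δ2 δ3 : ℝ)
    (γ01 γ21 γ31 δ11 δ21 δ31 : ℝ)
    (α02 α12 α32 β12 β22 β32 : ℝ)
    (p p₁ p₂ : ℝ)
    (hα0 : α0 ≠ 0) (hα3 : α3 ≠ 0) (hβ1 : β1 ≠ 0) (hβ2 : β2 ≠ 0)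
    (hγ0 : γ0 ≠ 0) (hγ3 : γ3 ≠ 0) (hδ1 : δ1 ≠ 0) (hδ2 : δ2 ≠ 0)
    (hγ01 : γ01 ≠ 0) (hγ31 : γ31 ≠ 0) (hδ11 : δ11 ≠ 0) (hδ21 : δ21 ≠ 0)
    (hα02 : α02 ≠ 0) (hα32 : α32 ≠ 0) (hβ12 : β12 ≠ 0) (hβ22 : β22 ≠ 0)
    (hp : p ≠ 0)
    -- discrete Gauss–Mainardi–Codazzi (compatibility) relations M₁L = L₂M
    (h1 : β1 = α32 * δ1) (h2 : β2 = α32 * δ2 + α02) (h3 : β3 = α32 * δ3 + α12)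
    (h4 : δ1 = γ31 * β1 + γ01) (h5 : δ2 = γ31 * β2) (h6 : δ3 = γ31 * β3 + γ21)
    (h7 : δ11 * α0 = β22 * γ0) (h8 : α1 * δ11 + β1 * δ31 = β32 * δ1)
    (h9 : δ31 * β2 = γ2 * β22 + δ2 * β32)
    (h10 : α3 * δ11 + β3 * δ31 + δ21 = γ3 * β22 + δ3 * β32 + β12)
    -- C¹ recursions
    (hp₁ : p₁ = α0 / (β2 * p)) (hp₂ : p₂ = γ0 / (δ1 * p))
    -- gauge condition
    (hgauge : (1 - p ^ 2) * β2 * δ1 = β1 * δ2)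
    -- the tangency maps
    (S1 S2 S12 S21 : ℝ → ℝ)
    (hS1 : ∀ s, S1 s = (α1 * β2 * p * s + 2 * α0 * β1 * p - α0 * β3 * s) /
      (p * (2 * α3 * β2 * s - α1 * β2 * p + α0 * β3)))
    (hS2 : ∀ s, S2 s = (2 * γ0 * δ1 * p - γ2 * δ1 * p * s - γ0 * δ3 * s) /
      (2 * δ1 * p * s))
    (hS12 : ∀ s, S12 s = (2 * γ01 * δ11 * p₁ - γ21 * δ11 * p₁ * s - γ01 * δ31 * s) /
      (2 * δ11 * p₁ * s))
    (hS21 : ∀ s, S21 s = (α12 * β22 * p₂ * s + 2 * α02 * β12 * p₂ - α02 * β32 * s) /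
      (p₂ * (2 * α32 * β22 * s - α12 * β22 * p₂ + α02 * β32)))
    (T1 T12 : ℝ)
    (hT1 : T1 = ((α0 * β3 - α1 * β2 * p) ^ 2 + 4 * α0 * α3 * β1 * β2 * p) /
      (α0 * β2 * p) ^ 2)
    (hT12 : T12 = ((α02 * β32 - α12 * β22 * p₂) ^ 2 +
      4 * α02 * α32 * β12 * β22 * p₂) / (α02 * β22 * p₂) ^ 2) :
    ∀ s : ℝ,
      p * (2 * α3 * β2 * s - α1 * β2 * p + α0 * β3) ≠ 0 →
      2 * δ1 * p * s ≠ 0 →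
      2 * δ11 * p₁ * S1 s ≠ 0 →
      p₂ * (2 * α32 * β22 * S2 s - α12 * β22 * p₂ + α02 * β32) ≠ 0 →
      (S12 (S1 s) = S21 (S2 s) ↔ T12 = T1) := by
  have hg31 : γ31 = (1 - p ^ 2) / α32 := by
    rw [eq_div_iff hα32]
    apply mul_right_cancel₀ (mul_ne_zero hβ2 hδ1)
    rw [h1, h5] at hgauge
    linear_combination -hgauge
  have hg01 : γ01 = p ^ 2 * δ1 := by
    rw [h1, hg31] at h4
    field_simp at h4
    linear_combination -h4
  have ha02 : α02 = p ^ 2 * β2 := by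
    rw [h5, hg31] at h2
    field_simp at h2
    linear_combination -h2
  have ha12 : α12 = β3 - α32 * δ3 := by linear_combination -h3
  have hg21 : γ21 = δ3 - (1 - p ^ 2) / α32 * β3 := by rw [← hg31]; linear_combination -h6
  have hg0 : γ0 = δ11 * α0 / β22 := by rw [eq_div_iff hβ22]; linear_combination -h7
  have hb32 : β32 = α1 * δ11 / δ1 + α32 * δ31 := by
    rw [h1] at h8
    field_simp
    linear_combination -h8
  have hg2 : γ2 = (p ^ 2 * δ31 * β2 - (1 - p ^ 2) / α32 * β2 * (α1 * δ11 / δ1)) / β22 := by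
    rw [h5, hg31, hb32] at h9
    field_simp at h9 ⊢
    linear_combination -h9
  intro s hD1 hs hX hD2
  have hs0 : s ≠ 0 := right_ne_zero_of_mul hs
  have hX0 : S1 s ≠ 0 := right_ne_zero_of_mul hX
  have hσ₂ := right_ne_zero_of_mul hD2
  have hN : α1 * β2 * p * s + 2 * α0 * β1 * p - α0 * β3 * s ≠ 0 := by
    intro h
    exact hX0 (by rw [hS1, h, zero_div])
  have hp₁0 : p₁ ≠ 0 := by rw [hp₁]; positivity
  have hp₂0 : p₂ ≠ 0 := by rw [hp₂]; positivity
  have hS21_den : 2 * α32 * β22 * S2 s - α12 * β22 * p₂ + α02 * β32 =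
      δ11 / (δ1 * p) *
        ((α1 * β2 * p * s + 2 * α0 * β1 * p - α0 * β3 * s) / s) := by
    rw [hS2, hp₂, hg2, ha12, ha02, hb32, hg0, h1]
    field_simp
    ring
  have hS12_eq : S12 (S1 s) = γ01 * (α0 * β3 - α1 * β2 * p) / (2 * α0 * β1) +
      γ01 * ((α0 * β3 - α1 * β2 * p) ^ 2 + 4 * α0 * α3 * β1 * β2 * p) / (2 * α0 * β1) *
        (s / (α1 * β2 * p * s + 2 * α0 * β1 * p - α0 * β3 * s)) -
      γ21 / 2 - γ01 * δ31 / (2 * δ11 * p₁) := by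
    have hinv : (S1 s)⁻¹ = p * (2 * α3 * β2 * s - α1 * β2 * p + α0 * β3) /
        (α1 * β2 * p * s + 2 * α0 * β1 * p - α0 * β3 * s) := by rw [hS1, inv_div]
    have hsplit : S12 (S1 s) = γ01 * (S1 s)⁻¹ - γ21 / 2 - γ01 * δ31 / (2 * δ11 * p₁) := by
      rw [hS12]
      field_simp
    rw [hsplit, hinv]
    generalize hn : α1 * β2 * p * s + 2 * α0 * β1 * p - α0 * β3 * s = n at hN
    field_simp
    rw [← hn]
    ring
  have hS21_eq : S21 (S2 s) =
      ((α02 * β32 - α12 * β22 * p₂) ^ 2 + 4 * α02 * α32 * β12 * β22 * p₂) /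
        (2 * α32 * β22 * p₂ * (2 * α32 * β22 * S2 s - α12 * β22 * p₂ + α02 * β32)) -
      (α02 * β32 - α12 * β22 * p₂) / (2 * α32 * β22 * p₂) := by
    rw [hS21]
    generalize hn : 2 * α32 * β22 * S2 s - α12 * β22 * p₂ + α02 * β32 = n at hσ₂
    field_simp
    rw [← hn]
    ring
  have hconst : γ01 * (α0 * β3 - α1 * β2 * p) / (2 * α0 * β1) - γ21 / 2 -
      γ01 * δ31 / (2 * δ11 * p₁) =
      -((α02 * β32 - α12 * β22 * p₂) / (2 * α32 * β22 * p₂)) := by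
    rw [hp₁, hp₂, hg01, hg21, ha12, ha02, hb32, hg0, h1]
    field_simp
    ring
  have hfactor : S12 (S1 s) - S21 (S2 s) = γ01 * α0 * β2 ^ 2 * p ^ 2 / (2 * β1) *
      (s / (α1 * β2 * p * s + 2 * α0 * β1 * p - α0 * β3 * s)) * (T1 - T12) := by
    have hT1_num : (α0 * β3 - α1 * β2 * p) ^ 2 + 4 * α0 * α3 * β1 * β2 * p =
        T1 * (α0 * β2 * p) ^ 2 := by rw [hT1]; field_simp
    have hT12_num : (α02 * β32 - α12 * β22 * p₂) ^ 2 + 4 * α02 * α32 * β12 * β22 * p₂ =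
        T12 * (α02 * β22 * p₂) ^ 2 := by rw [hT12]; field_simp
    rw [hS12_eq, hS21_eq, hS21_den, hT1_num, hT12_num]
    clear hT1_num hT12_num hS12_eq hS21_eq hS21_den
    generalize α1 * β2 * p * s + 2 * α0 * β1 * p - α0 * β3 * s = n at hN ⊢
    have hmain : γ01 * (T1 * (α0 * β2 * p) ^ 2) / (2 * α0 * β1) * (s / n) -
        T12 * (α02 * β22 * p₂) ^ 2 / (2 * α32 * β22 * p₂ * (δ11 / (δ1 * p) * (n / s))) =
        γ01 * α0 * β2 ^ 2 * p ^ 2 / (2 * β1) * (s / n) * (T1 - T12) := by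
      rw [hp₂, hg01, ha02, hg0, h1]
      field_simp
    linear_combination hmain + hconst
  have hcoef : γ01 * α0 * β2 ^ 2 * p ^ 2 / (2 * β1) *
      (s / (α1 * β2 * p * s + 2 * α0 * β1 * p - α0 * β3 * s)) ≠ 0 := by
    refine mul_ne_zero ?_ (div_ne_zero hs0 hN)
    positivity
  rw [← sub_eq_zero, hfactor, mul_eq_zero, or_iff_right hcoef, sub_eq_zero, eq_comm]
end

section
/- Assume the discrete Gauss–Mainardi–Codazzi (compatibility) relations. Let p ≠ 0 and define p₁ := α⁰/(β²p) and p₂ := γ⁰/(δ¹p) (the C¹ propagation of the quadric parameter in the two lattice directions). Then the two further propagations agree: γ⁰₁/(δ¹₁·p₁) = α⁰₂/(β²₂·p₂), i.e., p₁₂ = p₂₁. (Consequently a set of lattice Lie quadrics is uniquely and consistently determined by a single quadric associated with one quadrilateral of a discrete asymptotic net.) -/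
/-- consistency of the C¹ propagation of the quadric parameter:
`p₁₂ = γ⁰₁/(δ¹₁·p₁)` and `p₂₁ = α⁰₂/(β²₂·p₂)` coincide, so a set of lattice
Lie quadrics is uniquely determined by one quadric. -/
theorem stmt8
    (α0 α1 α3 β1 β2 β3 γ0 γ2 γ3 δ1 δ2 δ3 : ℝ)
    (γ01 γ21 γ31 δ11 δ21 δ31 : ℝ)
    (α02 α12 α32 β12 β22 β32 : ℝ)
    (hα0 : α0 ≠ 0) (hα3 : α3 ≠ 0) (hβ1 : β1 ≠ 0) (hβ2 : β2 ≠ 0)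
    (hγ0 : γ0 ≠ 0) (hγ3 : γ3 ≠ 0) (hδ1 : δ1 ≠ 0) (hδ2 : δ2 ≠ 0)
    (hγ01 : γ01 ≠ 0) (hγ31 : γ31 ≠ 0) (hδ11 : δ11 ≠ 0) (hδ21 : δ21 ≠ 0)
    (hα02 : α02 ≠ 0) (hα32 : α32 ≠ 0) (hβ12 : β12 ≠ 0) (hβ22 : β22 ≠ 0)
    -- discrete Gauss–Mainardi–Codazzi (compatibility) relations M₁L = L₂M
    (h1 : β1 = α32 * δ1) (h2 : β2 = α32 * δ2 + α02) (h3 : β3 = α32 * δ3 + α12)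
    (h4 : δ1 = γ31 * β1 + γ01) (h5 : δ2 = γ31 * β2) (h6 : δ3 = γ31 * β3 + γ21)
    (h7 : δ11 * α0 = β22 * γ0) (h8 : α1 * δ11 + β1 * δ31 = β32 * δ1)
    (h9 : δ31 * β2 = γ2 * β22 + δ2 * β32)
    (h10 : α3 * δ11 + β3 * δ31 + δ21 = γ3 * β22 + δ3 * β32 + β12)
    (p p₁ p₂ : ℝ) (hp : p ≠ 0)
    (hp₁ : p₁ = α0 / (β2 * p)) (hp₂ : p₂ = γ0 / (δ1 * p)) :
    γ01 / (δ11 * p₁) = α02 / (β22 * p₂) := by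
  have key : γ01 * β2 = α02 * δ1 := by
    linear_combination (-γ31 * β2) * h1 - β2 * h4 + δ1 * h2 + α32 * δ1 * h5
  have hleft : γ01 / (δ11 * p₁) = γ01 * β2 * p / (δ11 * α0) := by
    rw [hp₁]
    field_simp
  have hright : α02 / (β22 * p₂) = α02 * δ1 * p / (β22 * γ0) := by
    rw [hp₂]
    field_simp
  rw [hleft, hright, key, h7]
end

section
/- Assume the C¹ condition p₁·β²·p = α⁰ and D¹ = 0, where D¹ := (α⁰β³ − α¹β²p)² + 4α⁰α³β¹β²p. Set s₁ := (α¹β²p − α⁰β³)/(2α³β²p) and, for t ≠ 0, t₁ := 𝒯¹(t) = (2α⁰β²p − α¹β²pt − α⁰β³t)/(2β²pt). Then there exists λ ≠ 0 such that Q₁(s₁,t₁) = λ·Q(p·s₁, t), i.e., p₁·r₁₁₂ + s₁·r₁₁ + t₁·r₁₂ + s₁t₁·r₁ = λ·(p·r₁₂ + p s₁·r₁ + t·r₂ + p s₁ t·r). (Geometrically: for a discrete Godeaux-Rozet surface the neighbouring envelope point, regarded as a point of Q, is the intersection of the generator shared by Q and Q₁ with the generator of Q of the other family carrying the same parameter t.)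 -/
/-- for a discrete Godeaux-Rozet surface (`D¹ = 0`), the
neighbouring envelope point `Q₁(s₁,t₁)` is, as a point of `Q`, the intersection
of the shared generator with the generator of the other family labelled by the
same parameter `t`: `Q₁(s₁,t₁) = λ·Q(p·s₁, t)` for some `λ ≠ 0`. -/
theorem stmt10 (r r₁ r₂ r₁₂ : Fin 4 → ℝ)
    (hbasis : LinearIndependent ℝ ![r, r₁, r₂, r₁₂])
    (α0 α1 α3 β1 β2 β3 : ℝ)
    (hα0 : α0 ≠ 0) (hα3 : α3 ≠ 0) (hβ1 : β1 ≠ 0) (hβ2 : β2 ≠ 0)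
    (r₁₁ r₁₁₂ : Fin 4 → ℝ)
    (hr₁₁ : r₁₁ = α0 • r + α1 • r₁ + α3 • r₁₂)
    (hr₁₁₂ : r₁₁₂ = β1 • r₁ + β2 • r₂ + β3 • r₁₂)
    (p p₁ : ℝ) (hp : p ≠ 0) (hp₁ : p₁ ≠ 0)
    (hC1 : p₁ * β2 * p = α0)
    (hD1 : (α0 * β3 - α1 * β2 * p) ^ 2 + 4 * α0 * α3 * β1 * β2 * p = 0)
    (s₁ t t₁ : ℝ) (ht : t ≠ 0)
    (hs₁ : s₁ = (α1 * β2 * p - α0 * β3) / (2 * α3 * β2 * p))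
    (ht₁ : t₁ = (2 * α0 * β2 * p - α1 * β2 * p * t - α0 * β3 * t) /
      (2 * β2 * p * t)) :
    ∃ lam : ℝ, lam ≠ 0 ∧
      p₁ • r₁₁₂ + s₁ • r₁₁ + t₁ • r₁₂ + (s₁ * t₁) • r₁ =
        lam • (p • r₁₂ + (p * s₁) • r₁ + t • r₂ + (p * s₁ * t) • r) := by
  subst hC1
  have hs : 2 * α3 * s₁ = α1 - p₁ * β3 := by
    rw [hs₁]; field_simp
  have ht' : t₁ = p₁ * β2 * p / t - (α1 + p₁ * β3) / 2 := by
    rw [ht₁]; field_simp; ring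
  have hD : (p₁ * β3 - α1) ^ 2 + 4 * p₁ * α3 * β1 = 0 := by
    have h : (β2 * p) ^ 2 * ((p₁ * β3 - α1) ^ 2 + 4 * p₁ * α3 * β1) = 0 := by
      linear_combination hD1
    exact (mul_eq_zero.mp h).resolve_left (pow_ne_zero 2 (mul_ne_zero hβ2 hp))
  have hq : p₁ * β1 + α3 * s₁ ^ 2 = 0 := by
    have h : (4 * α3) * (p₁ * β1 + α3 * s₁ ^ 2) = 0 := by
      linear_combination hD + (2 * α3 * s₁ + α1 - p₁ * β3) * hs
    exact (mul_eq_zero.mp h).resolve_left (mul_ne_zero four_ne_zero hα3)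
  refine ⟨p₁ * β2 / t, div_ne_zero (mul_ne_zero hp₁ hβ2) ht, ?_⟩
  have h1 : p₁ * β1 + s₁ * α1 + s₁ * t₁ = p₁ * β2 / t * (p * s₁) := by
    rw [ht']; linear_combination hq - s₁ / 2 * hs
  have h2 : p₁ * β2 = p₁ * β2 / t * t := by field_simp
  have h12 : p₁ * β3 + s₁ * α3 + t₁ = p₁ * β2 / t * p := by
    rw [ht']; linear_combination hs / 2
  have h0 : s₁ * (p₁ * β2 * p) = p₁ * β2 / t * (p * s₁ * t) := by field_simp
  subst hr₁₁ hr₁₁₂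
  ext i
  simp only [Pi.add_apply, Pi.smul_apply, smul_eq_mul]
  linear_combination r i * h0 + r₁ i * h1 + r₂ i * h2 + r₁₂ i * h12
end

section
/- Let s, t : ℤ² → ℝ be nowhere-zero functions satisfying s(n + e₁)·t(n) = t(n + e₂)·s(n) for all n ∈ ℤ², where e₁ = (1,0) and e₂ = (0,1). Then there exists a nowhere-zero function φ : ℤ² → ℝ such that φ(n + e₁) = −t(n)·φ(n) and φ(n + e₂) = −s(n)·φ(n) for all n ∈ ℤ². (This is the potential whose existence is guaranteed by the discrete Tzitzéica condition s₁t = t₂s of coinciding intersection points of the line congruence.) -/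
/-- A first-order linear recurrence on `ℤ` with nonzero coefficients has a nowhere-zero solution
with initial value `1`. -/
theorem exists_int_recurrence_solution {K : Type*} [Field K] (a : ℤ → K) (ha : ∀ k, a k ≠ 0) :
    ∃ f : ℤ → K, f 0 = 1 ∧ (∀ k, f k ≠ 0) ∧ ∀ k, f (k + 1) = a k * f k := by
  refine ⟨fun k => match k with
    | Int.ofNat n => ∏ i ∈ Finset.range n, a i
    | Int.negSucc n => ∏ i ∈ Finset.range (n + 1), (a (Int.negSucc i))⁻¹, ?_, ?_, ?_⟩
  · exact Finset.prod_range_zero _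
  · rintro (n | n)
    · exact Finset.prod_ne_zero_iff.2 fun i _ => ha _
    · exact Finset.prod_ne_zero_iff.2 fun i _ => inv_ne_zero (ha _)
  · rintro (n | _ | n)
    · exact (Finset.prod_range_succ (fun i : ℕ => a i) n).trans (mul_comm _ _)
    · change ∏ i ∈ Finset.range 0, a i = a (Int.negSucc 0) *
        ∏ i ∈ Finset.range (0 + 1), (a (Int.negSucc i))⁻¹
      simp [ha]
    · change ∏ i ∈ Finset.range (n + 1), (a (Int.negSucc i))⁻¹ = a (Int.negSucc (n + 1)) *
        ∏ i ∈ Finset.range (n + 1 + 1), (a (Int.negSucc i))⁻¹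
      rw [Finset.prod_range_succ _ (n + 1), mul_left_comm, mul_inv_cancel₀ (ha _), mul_one]

/-- the discrete Tzitzéica condition `s₁·t = t₂·s` guarantees the
existence of a nowhere-zero potential `φ` on `ℤ²` with `φ₁ = −t·φ` and
`φ₂ = −s·φ`. -/
theorem stmt11 (s t : ℤ × ℤ → ℝ)
    (hs : ∀ n, s n ≠ 0) (ht : ∀ n, t n ≠ 0)
    (hcomp : ∀ n : ℤ × ℤ, s (n + (1, 0)) * t n = t (n + (0, 1)) * s n) :
    ∃ φ : ℤ × ℤ → ℝ, (∀ n, φ n ≠ 0) ∧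
      (∀ n : ℤ × ℤ, φ (n + (1, 0)) = -t n * φ n) ∧
      (∀ n : ℤ × ℤ, φ (n + (0, 1)) = -s n * φ n) := by
  obtain ⟨f, -, hf, hf1⟩ :=
    exists_int_recurrence_solution (fun m => -t (m, 0)) fun m => neg_ne_zero.2 (ht _)
  choose g hg0 hg hg1 using fun m : ℤ =>
    exists_int_recurrence_solution (fun n => -s (m, n)) fun n => neg_ne_zero.2 (hs _)
  have hc (m n : ℤ) : s (m + 1, n) * t (m, n) = t (m, n + 1) * s (m, n) := by
    simpa using hcomp (m, n)
  have key (m n : ℤ) : f (m + 1) * g (m + 1) n = -t (m, n) * (f m * g m n) := by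
    induction n using Int.induction_on with
    | zero => simp [hg0, hf1]
    | succ n ih =>
      rw [hg1, hg1]
      linear_combination -s (m + 1, (n : ℤ)) * ih + f m * g m n * hc m n
    | pred n ih =>
      have h := hc m (-n - 1)
      have h1 := hg1 (m + 1) (-n - 1)
      have h2 := hg1 m (-n - 1)
      rw [sub_add_cancel] at h h1 h2
      rw [h1, h2] at ih
      apply mul_left_cancel₀ (neg_ne_zero.2 (hs (m + 1, -n - 1)))
      linear_combination ih - f m * g m (-n - 1) * h
  refine ⟨fun p => f p.1 * g p.1 p.2, fun p => mul_ne_zero (hf _) (hg _ _), ?_, ?_⟩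
  · rintro ⟨m, n⟩
    simpa using key m n
  · rintro ⟨m, n⟩
    have h := hg1 m n
    simp only [Prod.mk_add_mk, add_zero, h]
    ring
end

section
/- Let r : ℝ² → ℝ⁴ and p, q, V, W : ℝ² → ℝ be smooth (C^∞) functions such that r satisfies the projective Gauss–Weingarten equations r_xx = p·r_y + (1/2)(V − p_y)·r and r_yy = q·r_x + (1/2)(W − q_x)·r on all of ℝ², and such that at every point the vectors r, r_x, r_y, r_xy are linearly independent. Then the projective Gauss–Mainardi–Codazzi equations hold: p_yyy − 2p_y·W − p·W_y = q_xxx − 2q_x·V − q·V_x, W_x = 2q·p_y + p·q_y, and V_y = 2p·q_x + q·p_x. -/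
/-- Partial derivative with respect to the first variable. -/
noncomputable def pd1 {E : Type*} [NormedAddCommGroup E] [NormedSpace ℝ E]
    (f : ℝ → ℝ → E) : ℝ → ℝ → E := fun x y => deriv (fun x' => f x' y) x

/-- Partial derivative with respect to the second variable. -/
noncomputable def pd2 {E : Type*} [NormedAddCommGroup E] [NormedSpace ℝ E]
    (f : ℝ → ℝ → E) : ℝ → ℝ → E := fun x y => deriv (fun y' => f x y') y

/-- Joint smoothness of a function of two real variables. -/
def JointlySmooth {E : Type*} [NormedAddCommGroup E] [NormedSpace ℝ E]
    (f : ℝ → ℝ → E) : Prop := ContDiff ℝ (⊤ : ℕ∞) (fun z : ℝ × ℝ => f z.1 z.2)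

section PartialDerivatives

variable {E : Type*} [NormedAddCommGroup E] [NormedSpace ℝ E] {f g : ℝ → ℝ → E} {c : ℝ → ℝ → ℝ}

namespace JointlySmooth

lemma swap (hf : JointlySmooth f) : JointlySmooth (fun x y => f y x) :=
  ContDiff.comp hf (contDiff_snd.prodMk contDiff_fst)

lemma differentiableAt_fst (hf : JointlySmooth f) (x y : ℝ) :
    DifferentiableAt ℝ (fun x' => f x' y) x :=
  ((ContDiff.comp hf (contDiff_id.prodMk contDiff_const)).differentiable (by simp)) x

lemma differentiableAt_snd (hf : JointlySmooth f) (x y : ℝ) :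
    DifferentiableAt ℝ (fun y' => f x y') y :=
  hf.swap.differentiableAt_fst y x

lemma pd1_eq_fderiv (hf : JointlySmooth f) (x y : ℝ) :
    pd1 f x y = fderiv ℝ (fun z : ℝ × ℝ => f z.1 z.2) (x, y) (1, 0) := by
  have h := (hf.differentiable (by simp) (x, y)).hasFDerivAt
  exact (HasFDerivAt.comp_hasDerivAt (f := fun x' : ℝ => (x', y)) x h
    ((hasDerivAt_id x).prodMk (hasDerivAt_const x y))).deriv

lemma pd2_eq_fderiv (hf : JointlySmooth f) (x y : ℝ) :
    pd2 f x y = fderiv ℝ (fun z : ℝ × ℝ => f z.1 z.2) (x, y) (0, 1) := by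
  have h := (hf.differentiable (by simp) (x, y)).hasFDerivAt
  exact (HasFDerivAt.comp_hasDerivAt (f := fun y' : ℝ => (x, y')) y h
    ((hasDerivAt_const y x).prodMk (hasDerivAt_id y))).deriv

lemma pd1 (hf : JointlySmooth f) : JointlySmooth (pd1 f) := by
  have h : ContDiff ℝ (⊤ : ℕ∞) (fun z : ℝ × ℝ =>
      fderiv ℝ (fun z : ℝ × ℝ => f z.1 z.2) z (1, 0)) :=
    (ContDiff.fderiv_right hf (by simp)).clm_apply contDiff_const
  unfold JointlySmooth
  rw [funext fun z : ℝ × ℝ => hf.pd1_eq_fderiv z.1 z.2]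
  exact h

lemma pd2 (hf : JointlySmooth f) : JointlySmooth (pd2 f) := hf.swap.pd1.swap

lemma add (hf : JointlySmooth f) (hg : JointlySmooth g) :
    JointlySmooth (fun x y => f x y + g x y) := ContDiff.add hf hg

lemma smul (hc : JointlySmooth c) (hf : JointlySmooth f) :
    JointlySmooth (fun x y => c x y • f x y) := ContDiff.smul hc hf

end JointlySmooth

/-- Mixed partial derivatives of a smooth function commute. -/
lemma pd1_pd2_comm (hf : JointlySmooth f) : pd1 (pd2 f) = pd2 (pd1 f) := by
  funext x y
  have hd : DifferentiableAt ℝ (fderiv ℝ (fun z : ℝ × ℝ => f z.1 z.2)) (x, y) :=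
    (ContDiff.fderiv_right (m := 1) hf (WithTop.coe_le_coe.2 (le_top : (2 : ℕ∞) ≤ ⊤))).differentiable (by simp) _
  have hsymm : IsSymmSndFDerivAt ℝ (fun z : ℝ × ℝ => f z.1 z.2) (x, y) :=
    ContDiffAt.isSymmSndFDerivAt hf.contDiffAt (by simpa using WithTop.coe_le_coe.2 (le_top : (2 : ℕ∞) ≤ ⊤))
  rw [hf.pd2.pd1_eq_fderiv, hf.pd1.pd2_eq_fderiv, funext fun z : ℝ × ℝ => hf.pd2_eq_fderiv z.1 z.2,
    funext fun z : ℝ × ℝ => hf.pd1_eq_fderiv z.1 z.2]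
  simp only [Prod.mk.eta]
  rw [fderiv_clm_apply hd (differentiableAt_const _), fderiv_clm_apply hd (differentiableAt_const _)]
  simpa using hsymm.eq (1, 0) (0, 1)

lemma pd1_add (hf : JointlySmooth f) (hg : JointlySmooth g) :
    pd1 (fun x y => f x y + g x y) = fun x y => pd1 f x y + pd1 g x y := by
  funext x y
  exact deriv_fun_add (hf.differentiableAt_fst x y) (hg.differentiableAt_fst x y)

lemma pd1_smul (hc : JointlySmooth c) (hf : JointlySmooth f) :
    pd1 (fun x y => c x y • f x y) = fun x y => c x y • pd1 f x y + pd1 c x y • f x y := by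
  funext x y
  exact deriv_fun_smul (hc.differentiableAt_fst x y) (hf.differentiableAt_fst x y)

lemma pd2_add (hf : JointlySmooth f) (hg : JointlySmooth g) :
    pd2 (fun x y => f x y + g x y) = fun x y => pd2 f x y + pd2 g x y := by
  funext x y
  exact deriv_fun_add (hf.differentiableAt_snd x y) (hg.differentiableAt_snd x y)

lemma pd2_smul (hc : JointlySmooth c) (hf : JointlySmooth f) :
    pd2 (fun x y => c x y • f x y) = fun x y => c x y • pd2 f x y + pd2 c x y • f x y := by
  funext x y
  exact deriv_fun_smul (hc.differentiableAt_snd x y) (hf.differentiableAt_snd x y)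

end PartialDerivatives

section CompatibilityConditions

variable {E : Type*} [NormedAddCommGroup E] [NormedSpace ℝ E] {r : ℝ → ℝ → E} {p q a b : ℝ → ℝ → ℝ}

/-- The expansion of `r_xxyy` in the frame `r, r_x, r_y, r_xy`. -/
lemma pd2_pd2_pd1_pd1_eq (hr : JointlySmooth r) (hp : JointlySmooth p) (hq : JointlySmooth q)
    (ha : JointlySmooth a) (hb : JointlySmooth b)
    (hxx : pd1 (pd1 r) = fun x y => p x y • pd2 r x y + a x y • r x y)
    (hyy : pd2 (pd2 r) = fun x y => q x y • pd1 r x y + b x y • r x y) (x y : ℝ) :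
    pd2 (pd2 (pd1 (pd1 r))) x y =
      (2 * pd2 p x y * b x y + p x y * pd2 b x y + pd2 (pd2 a) x y + a x y * b x y) • r x y +
      (2 * pd2 p x y * q x y + p x y * pd2 q x y + a x y * q x y) • pd1 r x y +
      (p x y * b x y + 2 * pd2 a x y + pd2 (pd2 p) x y) • pd2 r x y +
      (p x y * q x y) • pd2 (pd1 r) x y := by
  have hpy := hp.pd2
  have hay := ha.pd2
  have hrx := hr.pd1
  have hry := hr.pd2
  have hqrx := hq.smul hrx
  have hbr := hb.smul hr
  rw [hxx, pd2_add (hp.smul hry) (ha.smul hr), pd2_smul hp hry, pd2_smul ha hr, hyy,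
    pd2_add ((hp.smul (hqrx.add hbr)).add (hpy.smul hry)) ((ha.smul hry).add (hay.smul hr)),
    pd2_add (hp.smul (hqrx.add hbr)) (hpy.smul hry), pd2_add (ha.smul hry) (hay.smul hr),
    pd2_smul hp (hqrx.add hbr), pd2_add hqrx hbr, pd2_smul hq hrx, pd2_smul hb hr,
    pd2_smul hpy hry, pd2_smul ha hry, pd2_smul hay hr, hyy]
  module

lemma pd1_pd1_pd2_pd2_eq (hr : JointlySmooth r) (hp : JointlySmooth p) (hq : JointlySmooth q)
    (ha : JointlySmooth a) (hb : JointlySmooth b)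
    (hxx : pd1 (pd1 r) = fun x y => p x y • pd2 r x y + a x y • r x y)
    (hyy : pd2 (pd2 r) = fun x y => q x y • pd1 r x y + b x y • r x y) (x y : ℝ) :
    pd1 (pd1 (pd2 (pd2 r))) x y =
      (2 * pd1 q x y * a x y + q x y * pd1 a x y + pd1 (pd1 b) x y + b x y * a x y) • r x y +
      (2 * pd1 q x y * p x y + q x y * pd1 p x y + b x y * p x y) • pd2 r x y +
      (q x y * a x y + 2 * pd1 b x y + pd1 (pd1 q) x y) • pd1 r x y +
      (q x y * p x y) • pd2 (pd1 r) x y := by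
  rw [← pd1_pd2_comm hr]
  exact pd2_pd2_pd1_pd1_eq hr.swap hq.swap hp.swap hb.swap ha.swap
    (funext₂ fun s t => congrFun₂ hyy t s) (funext₂ fun s t => congrFun₂ hxx t s) y x

/-- The compatibility conditions of `r_xx = p r_y + a r`, `r_yy = q r_x + b r`. -/
lemma compatibility_conditions (hr : JointlySmooth r) (hp : JointlySmooth p)
    (hq : JointlySmooth q) (ha : JointlySmooth a) (hb : JointlySmooth b)
    (hxx : pd1 (pd1 r) = fun x y => p x y • pd2 r x y + a x y • r x y)
    (hyy : pd2 (pd2 r) = fun x y => q x y • pd1 r x y + b x y • r x y) {x y : ℝ}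
    (hindep : LinearIndependent ℝ ![r x y, pd1 r x y, pd2 r x y, pd2 (pd1 r) x y]) :
    2 * pd2 p x y * b x y + p x y * pd2 b x y + pd2 (pd2 a) x y =
        2 * pd1 q x y * a x y + q x y * pd1 a x y + pd1 (pd1 b) x y ∧
      2 * q x y * pd2 p x y + p x y * pd2 q x y = 2 * pd1 b x y + pd1 (pd1 q) x y ∧
      2 * p x y * pd1 q x y + q x y * pd1 p x y = 2 * pd2 a x y + pd2 (pd2 p) x y := by
  have hmixed : pd2 (pd2 (pd1 (pd1 r))) = pd1 (pd1 (pd2 (pd2 r))) := by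
    rw [← pd1_pd2_comm hr.pd1, ← pd1_pd2_comm hr, ← pd1_pd2_comm hr.pd2.pd1,
      ← pd1_pd2_comm hr.pd2]
  have h := congrFun₂ hmixed x y
  rw [pd2_pd2_pd1_pd1_eq hr hp hq ha hb hxx hyy, pd1_pd1_pd2_pd2_eq hr hp hq ha hb hxx hyy] at h
  have hcoeff := Fintype.linearIndependent_iff.1 hindep
    ![2 * pd2 p x y * b x y + p x y * pd2 b x y + pd2 (pd2 a) x y -
        (2 * pd1 q x y * a x y + q x y * pd1 a x y + pd1 (pd1 b) x y),
      2 * q x y * pd2 p x y + p x y * pd2 q x y - (2 * pd1 b x y + pd1 (pd1 q) x y),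
      2 * pd2 a x y + pd2 (pd2 p) x y - (2 * p x y * pd1 q x y + q x y * pd1 p x y), 0]
    (by
      simp only [Fin.sum_univ_four, Matrix.cons_val]
      linear_combination (norm := module) h)
  have h0 := hcoeff 0
  have h1 := hcoeff 1
  have h2 := hcoeff 2
  simp only [Matrix.cons_val] at h0 h1 h2
  exact ⟨by linarith, by linarith, by linarith⟩

end CompatibilityConditions

/-- the projective Gauss–Weingarten equations imply the
projective Gauss–Mainardi–Codazzi equations. -/
theorem stmt14 (r : ℝ → ℝ → (Fin 4 → ℝ)) (p q V W : ℝ → ℝ → ℝ)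
    (hr : ContDiff ℝ (⊤ : ℕ∞) (fun z : ℝ × ℝ => r z.1 z.2))
    (hp : ContDiff ℝ (⊤ : ℕ∞) (fun z : ℝ × ℝ => p z.1 z.2))
    (hq : ContDiff ℝ (⊤ : ℕ∞) (fun z : ℝ × ℝ => q z.1 z.2))
    (hV : ContDiff ℝ (⊤ : ℕ∞) (fun z : ℝ × ℝ => V z.1 z.2))
    (hW : ContDiff ℝ (⊤ : ℕ∞) (fun z : ℝ × ℝ => W z.1 z.2))
    (hGW1 : ∀ x y, pd1 (pd1 r) x y =
      p x y • pd2 r x y + ((1 / 2) * (V x y - pd2 p x y)) • r x y)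
    (hGW2 : ∀ x y, pd2 (pd2 r) x y =
      q x y • pd1 r x y + ((1 / 2) * (W x y - pd1 q x y)) • r x y)
    (hindep : ∀ x y,
      LinearIndependent ℝ ![r x y, pd1 r x y, pd2 r x y, pd2 (pd1 r) x y]) :
    ∀ x y,
      (pd2 (pd2 (pd2 p)) x y - 2 * pd2 p x y * W x y - p x y * pd2 W x y =
        pd1 (pd1 (pd1 q)) x y - 2 * pd1 q x y * V x y - q x y * pd1 V x y) ∧
      (pd1 W x y = 2 * q x y * pd2 p x y + p x y * pd2 q x y) ∧
      (pd2 V x y = 2 * p x y * pd1 q x y + q x y * pd1 p x y) := by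
  have hr : JointlySmooth r := hr
  have hp : JointlySmooth p := hp
  have hq : JointlySmooth q := hq
  have hV : JointlySmooth V := hV
  have hW : JointlySmooth W := hW
  have ha : JointlySmooth (fun x y => (1 / 2) * (V x y - pd2 p x y)) :=
    contDiff_const.mul (ContDiff.sub hV hp.pd2)
  have hb : JointlySmooth (fun x y => (1 / 2) * (W x y - pd1 q x y)) :=
    contDiff_const.mul (ContDiff.sub hW hq.pd1)
  obtain ⟨a, hadef⟩ : ∃ a : ℝ → ℝ → ℝ, a = fun x y => (1 / 2) * (V x y - pd2 p x y) := ⟨_, rfl⟩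
  obtain ⟨b, hbdef⟩ : ∃ b : ℝ → ℝ → ℝ, b = fun x y => (1 / 2) * (W x y - pd1 q x y) := ⟨_, rfl⟩
  rw [← hadef] at ha
  rw [← hbdef] at hb
  have hcompat := fun x y => compatibility_conditions hr hp hq ha hb
    (by rw [hadef]; exact funext₂ hGW1) (by rw [hbdef]; exact funext₂ hGW2) (hindep x y)
  have hVa : V = fun x y => a x y + (a x y + pd2 p x y) := by
    funext x y; rw [hadef]; ring
  have hWb : W = fun x y => b x y + (b x y + pd1 q x y) := by
    funext x y; rw [hbdef]; ring
  have hVx : pd1 V = fun x y => pd1 a x y + (pd1 a x y + pd2 (pd1 p) x y) := by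
    rw [hVa, pd1_add ha (ha.add hp.pd2), pd1_add ha hp.pd2, pd1_pd2_comm hp]
  have hVy : pd2 V = fun x y => pd2 a x y + (pd2 a x y + pd2 (pd2 p) x y) := by
    rw [hVa, pd2_add ha (ha.add hp.pd2), pd2_add ha hp.pd2]
  have hWx : pd1 W = fun x y => pd1 b x y + (pd1 b x y + pd1 (pd1 q) x y) := by
    rw [hWb, pd1_add hb (hb.add hq.pd1), pd1_add hb hq.pd1]
  have hWy : pd2 W = fun x y => pd2 b x y + (pd2 b x y + pd2 (pd1 q) x y) := by
    rw [hWb, pd2_add hb (hb.add hq.pd1), pd2_add hb hq.pd1]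
  have hVy_eq : pd2 V = fun x y => p x y • pd1 q x y + (p x y • pd1 q x y + q x y • pd1 p x y) := by
    funext x y
    simp only [hVy, smul_eq_mul]
    linarith [(hcompat x y).2.2]
  have hWx_eq : pd1 W = fun x y => q x y • pd2 p x y + (q x y • pd2 p x y + p x y • pd2 q x y) := by
    funext x y
    simp only [hWx, smul_eq_mul]
    linarith [(hcompat x y).2.1]
  have hpqx := hp.smul hq.pd1
  have hqpx := hq.smul hp.pd1
  have hqpy := hq.smul hp.pd2
  have hpqy := hp.smul hq.pd2
  have hVyy := congrArg pd2 hVy_eq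
  rw [hVy, pd2_add ha.pd2 (ha.pd2.add hp.pd2.pd2), pd2_add ha.pd2 hp.pd2.pd2,
    pd2_add hpqx (hpqx.add hqpx), pd2_add hpqx hqpx, pd2_smul hp hq.pd1, pd2_smul hq hp.pd1] at hVyy
  have hWxx := congrArg pd1 hWx_eq
  rw [hWx, pd1_add hb.pd1 (hb.pd1.add hq.pd1.pd1), pd1_add hb.pd1 hq.pd1.pd1,
    pd1_add hqpy (hqpy.add hpqy), pd1_add hqpy hpqy, pd1_smul hq hp.pd2, pd1_smul hp hq.pd2,
    pd1_pd2_comm hp, pd1_pd2_comm hq] at hWxx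
  intro x y
  have hyy := congrFun₂ hVyy x y
  have hxx := congrFun₂ hWxx x y
  simp only [smul_eq_mul] at hyy hxx
  refine ⟨?_, ?_, ?_⟩
  · simp only [hVx, hWy, congrFun₂ hVa x y, congrFun₂ hWb x y]
    linear_combination hyy - hxx - 2 * (hcompat x y).1
  · simp only [hWx_eq, smul_eq_mul]
    ring
  · simp only [hVy_eq, smul_eq_mul]
    ring
end

section
/- Let p, q, V, W : ℝ² → ℝ be smooth functions with p and q nowhere zero, and define α := p²·W − p·p_yy + (p_y)²/2 and β := q²·V − q·q_xx + (q_x)²/2. Then at every point, α_y/p = β_x/q holds if and only if p_yyy − 2p_y·W − p·W_y = q_xxx − 2q_x·V − q·V_x holds. (Thus the first projective Gauss–Mainardi–Codazzi equation is equivalent to the relation α_y/p = β_x/q, and the Euler–Lagrange condition for projective minimality is α_y/p = β_x/q = 0.) -/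
/-- The pointwise factorisation of the derivative of the invariant built from one-variable
functions f and g: it is divisible by f. -/
theorem hasDerivAt_sq_mul_sub_mul_deriv_deriv_add {f g : ℝ → ℝ} (hf : ContDiff ℝ 3 f)
    (hg : Differentiable ℝ g) (t : ℝ) :
    HasDerivAt (fun s => f s ^ 2 * g s - f s * deriv (deriv f) s + (deriv f s) ^ 2 / 2)
      (-f t * (deriv (deriv (deriv f)) t - 2 * deriv f t * g t - f t * deriv g t)) t := by
  have hf₁ : ContDiff ℝ 2 (deriv f) := ContDiff.deriv' (n := 2) hf
  have hf₂ : ContDiff ℝ 1 (deriv (deriv f)) := ContDiff.deriv' (n := 1) hf₁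
  have h₀ := (hf.differentiable (by norm_num) t).hasDerivAt
  have h₁ := (hf₁.differentiable (by norm_num) t).hasDerivAt
  have h₂ := (hf₂.differentiable (by norm_num) t).hasDerivAt
  refine ((((h₀.pow 2).mul (hg t).hasDerivAt).sub (h₀.mul h₂)).add
    ((h₁.pow 2).div_const 2)).congr_deriv ?_
  simp only [Pi.pow_apply]
  push_cast
  ring

/-- with `α = p²W − p·p_yy + p_y²/2` and
`β = q²V − q·q_xx + q_x²/2`, the relation `α_y/p = β_x/q` holds at a point if
and only if the first projective Gauss–Mainardi–Codazzi equation
`p_yyy − 2p_y·W − p·W_y = q_xxx − 2q_x·V − q·V_x` holds there. -/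
theorem stmt15 (p q V W : ℝ → ℝ → ℝ)
    (hp : ContDiff ℝ (⊤ : ℕ∞) (fun z : ℝ × ℝ => p z.1 z.2))
    (hq : ContDiff ℝ (⊤ : ℕ∞) (fun z : ℝ × ℝ => q z.1 z.2))
    (hV : ContDiff ℝ (⊤ : ℕ∞) (fun z : ℝ × ℝ => V z.1 z.2))
    (hW : ContDiff ℝ (⊤ : ℕ∞) (fun z : ℝ × ℝ => W z.1 z.2))
    (hpne : ∀ x y, p x y ≠ 0) (hqne : ∀ x y, q x y ≠ 0)
    (α β : ℝ → ℝ → ℝ)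
    (hα : ∀ x y, α x y =
      p x y ^ 2 * W x y - p x y * pd2 (pd2 p) x y + (pd2 p x y) ^ 2 / 2)
    (hβ : ∀ x y, β x y =
      q x y ^ 2 * V x y - q x y * pd1 (pd1 q) x y + (pd1 q x y) ^ 2 / 2) :
    ∀ x y,
      pd2 α x y / p x y = pd1 β x y / q x y ↔
      pd2 (pd2 (pd2 p)) x y - 2 * pd2 p x y * W x y - p x y * pd2 W x y =
        pd1 (pd1 (pd1 q)) x y - 2 * pd1 q x y * V x y - q x y * pd1 V x y := by
  intro x y
  have hp' : ContDiff ℝ 3 (fun t => p x t) :=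
    (hp.comp (contDiff_const.prodMk contDiff_id)).of_le (WithTop.coe_le_coe.2 le_top)
  have hq' : ContDiff ℝ 3 (fun t => q t y) :=
    (hq.comp (contDiff_id.prodMk contDiff_const)).of_le (WithTop.coe_le_coe.2 le_top)
  have hW' : Differentiable ℝ (fun t => W x t) :=
    (hW.comp (contDiff_const.prodMk contDiff_id)).differentiable (by simp)
  have hV' : Differentiable ℝ (fun t => V t y) :=
    (hV.comp (contDiff_id.prodMk contDiff_const)).differentiable (by simp)
  have hα' : pd2 α x y = -p x y *
      (pd2 (pd2 (pd2 p)) x y - 2 * pd2 p x y * W x y - p x y * pd2 W x y) := by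
    rw [pd2, funext (hα x)]
    exact (hasDerivAt_sq_mul_sub_mul_deriv_deriv_add hp' hW' y).deriv
  have hβ' : pd1 β x y = -q x y *
      (pd1 (pd1 (pd1 q)) x y - 2 * pd1 q x y * V x y - q x y * pd1 V x y) := by
    rw [pd1, funext fun t => hβ t y]
    exact (hasDerivAt_sq_mul_sub_mul_deriv_deriv_add hq' hV' x).deriv
  rw [hα', hβ', neg_mul, neg_mul, neg_div, neg_div, mul_div_cancel_left₀ _ (hpne x y),
    mul_div_cancel_left₀ _ (hqne x y), neg_inj]
end

section
/- Let p, q, W : ℝ² → ℝ be smooth functions with p nowhere zero, and define α := p²·W − p·p_yy + (p_y)²/2 and A := p_xy − p_x·p_y/p − p²·q (so that (ln p)_xy = pq + A/p where p > 0). If W_x = 2q·p_y + p·q_y everywhere, then A_y = −p·(α/p²)_x everywhere. -/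
/-- Partial derivatives in the first variable are directional derivatives along `(1, 0)`. -/
lemma pd1_eq_fderiv {f : ℝ → ℝ → ℝ} (hf : Differentiable ℝ (fun z : ℝ × ℝ => f z.1 z.2))
    (x y : ℝ) : pd1 f x y = fderiv ℝ (fun z : ℝ × ℝ => f z.1 z.2) (x, y) (1, 0) :=
  HasDerivAt.deriv (f := fun x' => f x' y) <|
    HasFDerivAt.comp_hasDerivAt (l := fun z : ℝ × ℝ => f z.1 z.2) x (hf (x, y)).hasFDerivAt
    ((hasDerivAt_id x).prodMk (hasDerivAt_const x y))

/-- Partial derivatives in the second variable are directional derivatives along `(0, 1)`. -/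
lemma pd2_eq_fderiv {f : ℝ → ℝ → ℝ} (hf : Differentiable ℝ (fun z : ℝ × ℝ => f z.1 z.2))
    (x y : ℝ) : pd2 f x y = fderiv ℝ (fun z : ℝ × ℝ => f z.1 z.2) (x, y) (0, 1) :=
  HasDerivAt.deriv (f := fun y' => f x y') <|
    HasFDerivAt.comp_hasDerivAt (l := fun z : ℝ × ℝ => f z.1 z.2) y (hf (x, y)).hasFDerivAt
    ((hasDerivAt_const y x).prodMk (hasDerivAt_id y))

lemma hasDerivAt_pd1 {f : ℝ → ℝ → ℝ}
    (hf : ContDiff ℝ (⊤ : ℕ∞) (fun z : ℝ × ℝ => f z.1 z.2)) (x y : ℝ) :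
    HasDerivAt (fun x' => f x' y) (pd1 f x y) x := by
  have hd := hf.differentiable (by simp)
  rw [pd1_eq_fderiv hd]
  exact HasFDerivAt.comp_hasDerivAt (l := fun z : ℝ × ℝ => f z.1 z.2) x (hd (x, y)).hasFDerivAt
    ((hasDerivAt_id x).prodMk (hasDerivAt_const x y))

lemma hasDerivAt_pd2 {f : ℝ → ℝ → ℝ}
    (hf : ContDiff ℝ (⊤ : ℕ∞) (fun z : ℝ × ℝ => f z.1 z.2)) (x y : ℝ) :
    HasDerivAt (fun y' => f x y') (pd2 f x y) y := by
  have hd := hf.differentiable (by simp)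
  rw [pd2_eq_fderiv hd]
  exact HasFDerivAt.comp_hasDerivAt (l := fun z : ℝ × ℝ => f z.1 z.2) y (hd (x, y)).hasFDerivAt
    ((hasDerivAt_const y x).prodMk (hasDerivAt_id y))

lemma contDiff_pd1 {f : ℝ → ℝ → ℝ}
    (hf : ContDiff ℝ (⊤ : ℕ∞) (fun z : ℝ × ℝ => f z.1 z.2)) :
    ContDiff ℝ (⊤ : ℕ∞) (fun z : ℝ × ℝ => pd1 f z.1 z.2) := by
  simp only [pd1_eq_fderiv (hf.differentiable (by simp))]
  exact (hf.fderiv_right (m := (⊤ : ℕ∞)) (by simp)).clm_apply contDiff_const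

lemma contDiff_pd2 {f : ℝ → ℝ → ℝ}
    (hf : ContDiff ℝ (⊤ : ℕ∞) (fun z : ℝ × ℝ => f z.1 z.2)) :
    ContDiff ℝ (⊤ : ℕ∞) (fun z : ℝ × ℝ => pd2 f z.1 z.2) := by
  simp only [pd2_eq_fderiv (hf.differentiable (by simp))]
  exact (hf.fderiv_right (m := (⊤ : ℕ∞)) (by simp)).clm_apply contDiff_const

/-- Mixed partial derivatives of a smooth function commute. -/
lemma pd1_pd2_comm_s16 {f : ℝ → ℝ → ℝ}
    (hf : ContDiff ℝ (⊤ : ℕ∞) (fun z : ℝ × ℝ => f z.1 z.2)) :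
    pd1 (pd2 f) = pd2 (pd1 f) := by
  funext x y
  have hd := hf.differentiable (by simp)
  have hdd : Differentiable ℝ (fderiv ℝ (fun z : ℝ × ℝ => f z.1 z.2)) :=
    (hf.fderiv_right (m := (⊤ : ℕ∞)) (by simp)).differentiable (by simp)
  have hsymm := second_derivative_symmetric (fun z => (hd z).hasFDerivAt)
    (hdd (x, y)).hasFDerivAt (1, 0) (0, 1)
  rw [pd1_eq_fderiv ((contDiff_pd2 hf).differentiable (by simp)),
    pd2_eq_fderiv ((contDiff_pd1 hf).differentiable (by simp))]
  simp only [pd1_eq_fderiv hd, pd2_eq_fderiv hd, Prod.mk.eta]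
  rw [fderiv_clm_apply (hdd _) (differentiableAt_const _),
    fderiv_clm_apply (hdd _) (differentiableAt_const _)]
  simpa using hsymm

/-- with `α = p²W − p·p_yy + p_y²/2` and
`A = p_xy − p_x·p_y/p − p²·q` (so that `(ln p)_xy = pq + A/p`), the
Gauss–Mainardi–Codazzi equation `W_x = 2q·p_y + p·q_y` implies
`A_y = −p·(α/p²)_x`. -/
theorem stmt16 (p q W : ℝ → ℝ → ℝ)
    (hp : ContDiff ℝ (⊤ : ℕ∞) (fun z : ℝ × ℝ => p z.1 z.2))
    (hq : ContDiff ℝ (⊤ : ℕ∞) (fun z : ℝ × ℝ => q z.1 z.2))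
    (hW : ContDiff ℝ (⊤ : ℕ∞) (fun z : ℝ × ℝ => W z.1 z.2))
    (hpne : ∀ x y, p x y ≠ 0)
    (α A : ℝ → ℝ → ℝ)
    (hα : ∀ x y, α x y =
      p x y ^ 2 * W x y - p x y * pd2 (pd2 p) x y + (pd2 p x y) ^ 2 / 2)
    (hA : ∀ x y, A x y =
      pd2 (pd1 p) x y - pd1 p x y * pd2 p x y / p x y - p x y ^ 2 * q x y)
    (hGMC : ∀ x y, pd1 W x y = 2 * q x y * pd2 p x y + p x y * pd2 q x y) :
    ∀ x y, pd2 A x y =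
      -(p x y * pd1 (fun x' y' => α x' y' / p x' y' ^ 2) x y) := by
  intro x y
  have hp1 := contDiff_pd1 hp
  have hp2 := contDiff_pd2 hp
  have hmix : pd1 (pd2 (pd2 p)) x y = pd2 (pd2 (pd1 p)) x y := by
    rw [pd1_pd2_comm_s16 hp2, pd1_pd2_comm_s16 hp]
  have hA' := ((hasDerivAt_pd2 (contDiff_pd2 hp1) x y).sub
      (((hasDerivAt_pd2 hp1 x y).mul (hasDerivAt_pd2 hp2 x y)).div
        (hasDerivAt_pd2 hp x y) (hpne x y))).sub
      (((hasDerivAt_pd2 hp x y).pow 2).mul (hasDerivAt_pd2 hq x y))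
  have hα' := ((((((hasDerivAt_pd1 hp x y).pow 2).mul (hasDerivAt_pd1 hW x y)).sub
      ((hasDerivAt_pd1 hp x y).mul (hasDerivAt_pd1 (contDiff_pd2 hp2) x y))).add
      (((hasDerivAt_pd1 hp2 x y).pow 2).div_const 2))).div
      ((hasDerivAt_pd1 hp x y).pow 2) (pow_ne_zero 2 (hpne x y))
  have hL : pd2 A x y = _ :=
    (congrArg (deriv · y) (funext fun y' => hA x y')).trans hA'.deriv
  have hR : pd1 (fun x' y' => α x' y' / p x' y' ^ 2) x y = _ :=
    (congrArg (deriv · x) (funext fun x' => congrArg (· / p x' y ^ 2) (hα x' y))).trans hα'.deriv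
  rw [hL, hR, hmix, pd1_pd2_comm_s16 hp, hGMC]
  have := hpne x y
  simp only [Pi.mul_apply, Pi.pow_apply, Pi.sub_apply, Pi.add_apply]
  field_simp
  ring
end
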